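/- arXiv:2202.13993 — 2 statements merged into one kernel-verified Lean document; each statement's English description precedes it below -/
import Mathlib

section
/- Let A = (A_1,…,A_g) be a g-tuple of d×d Hermitian complex matrices. Then ‖A‖_c ≤ 1 if and only if there exist finitely many vectors z_j ∈ [−1,1]^g and d×d positive semidefinite matrices X_j with ∑_j X_j = I and A_i = ∑_j z_j(i) X_j for all i ∈ [g]. That is, the unit ball of the compatibility norm equals the level-d set of the minimal matrix convex set W^min_d over the cube [−1,1]^g. -/
open Matrix ComplexOrder

noncomputable section

/-- The largest eigenvalue of a (Hermitian) matrix, characterized via the Loewner order. -/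
noncomputable def lambdaMax {d : ℕ} (M : Matrix (Fin d) (Fin d) ℂ) : ℝ :=
  sInf {t : ℝ | (t • (1 : Matrix (Fin d) (Fin d) ℂ) - M).PosSemidef}

/-- The compatibility norm `‖A‖_c`: infimum of `λ_max (∑ j, H j)` over finite decompositions
`A i = ∑ j, z j i • H j` with `‖z j‖_∞ ≤ 1` and `H j` positive semidefinite. -/
noncomputable def cNorm {g d : ℕ} (A : Fin g → Matrix (Fin d) (Fin d) ℂ) : ℝ :=
  sInf {t : ℝ | ∃ (n : ℕ) (z : Fin n → Fin g → ℝ) (H : Fin n → Matrix (Fin d) (Fin d) ℂ),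
    (∀ j i, |z j i| ≤ 1) ∧ (∀ j, (H j).PosSemidef) ∧
    (∀ i, A i = ∑ j, z j i • H j) ∧ t = lambdaMax (∑ j, H j)}

section BoundsOnMatrices

open MatrixOrder Matrix.Norms.L2Operator

theorem exists_posSemidef_smul_one_sub {d : ℕ} {M : Matrix (Fin d) (Fin d) ℂ}
    (hM : M.IsHermitian) :
    ∃ t : ℝ, (t • (1 : Matrix (Fin d) (Fin d) ℂ) - M).PosSemidef := by
  have h : IsSelfAdjoint M := hM
  refine ⟨‖M‖, ?_⟩
  have := h.le_algebraMap_norm_self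
  rwa [Algebra.algebraMap_eq_smul_one] at this

theorem isClosed_setOf_posSemidef (d : ℕ) :
    IsClosed {M : Matrix (Fin d) (Fin d) ℂ | M.PosSemidef} := by
  simpa only [Matrix.nonneg_iff_posSemidef] using
    (CStarAlgebra.isClosed_nonneg (A := Matrix (Fin d) (Fin d) ℂ))

theorem isCompact_setOf_posSemidef_le (d : ℕ) (t : ℝ) :
    IsCompact {M : Matrix (Fin d) (Fin d) ℂ |
      M.PosSemidef ∧ (t • (1 : Matrix (Fin d) (Fin d) ℂ) - M).PosSemidef} := by
  have : ProperSpace (Matrix (Fin d) (Fin d) ℂ) := FiniteDimensional.proper ℂ _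
  refine (isCompact_closedBall (0 : Matrix (Fin d) (Fin d) ℂ)
    ‖t • (1 : Matrix (Fin d) (Fin d) ℂ)‖).of_isClosed_subset ?_ ?_
  · exact (isClosed_setOf_posSemidef d).inter
      ((isClosed_setOf_posSemidef d).preimage (continuous_const.sub continuous_id))
  · rintro M ⟨h0, h1⟩
    rw [mem_closedBall_zero_iff]
    exact CStarAlgebra.norm_le_norm_of_nonneg_of_le h0.nonneg h1

end BoundsOnMatrices

theorem Matrix.PosSemidef.smul_one_sub_mono {d : ℕ} {M : Matrix (Fin d) (Fin d) ℂ} {s t : ℝ}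
    (hst : s ≤ t) (h : (s • (1 : Matrix (Fin d) (Fin d) ℂ) - M).PosSemidef) :
    (t • (1 : Matrix (Fin d) (Fin d) ℂ) - M).PosSemidef := by
  have := (PosSemidef.one (n := Fin d) (R := ℂ)).smul (sub_nonneg.2 hst)
  convert! this.add h using 1
  rw [sub_smul]
  abel

theorem nonneg_of_posSemidef_smul_one_sub {d : ℕ} [NeZero d] {M : Matrix (Fin d) (Fin d) ℂ}
    (hM : M.PosSemidef) {t : ℝ} (h : (t • (1 : Matrix (Fin d) (Fin d) ℂ) - M).PosSemidef) :
    0 ≤ t := by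
  have := (h.add hM).diag_nonneg (i := 0)
  simpa using this

theorem lambdaMax_eq_zero_of_dim_zero (M : Matrix (Fin 0) (Fin 0) ℂ) : lambdaMax M = 0 := by
  have h : {t : ℝ | (t • (1 : Matrix (Fin 0) (Fin 0) ℂ) - M).PosSemidef} = Set.univ :=
    Set.eq_univ_of_forall fun t => by
      rw [Set.mem_ofPred_eq, Subsingleton.elim (t • (1 : Matrix (Fin 0) (Fin 0) ℂ) - M) 0]
      exact PosSemidef.zero
  rw [lambdaMax, h, Real.sInf_univ]

theorem lambdaMax_nonneg {d : ℕ} {M : Matrix (Fin d) (Fin d) ℂ} (hM : M.PosSemidef) :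
    0 ≤ lambdaMax M := by
  rcases Nat.eq_zero_or_pos d with rfl | hd
  · rw [lambdaMax_eq_zero_of_dim_zero]
  · have : NeZero d := ⟨hd.ne'⟩
    exact Real.sInf_nonneg fun t ht => nonneg_of_posSemidef_smul_one_sub hM ht

theorem lambdaMax_one_le (d : ℕ) : lambdaMax (1 : Matrix (Fin d) (Fin d) ℂ) ≤ 1 := by
  rcases Nat.eq_zero_or_pos d with rfl | hd
  · simp [lambdaMax_eq_zero_of_dim_zero]
  · have : NeZero d := ⟨hd.ne'⟩
    refine csInf_le ⟨0, fun t ht => nonneg_of_posSemidef_smul_one_sub PosSemidef.one ht⟩ ?_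
    rw [Set.mem_ofPred_eq, one_smul, sub_self]
    exact PosSemidef.zero

theorem posSemidef_smul_one_sub_of_lambdaMax_lt {d : ℕ} {M : Matrix (Fin d) (Fin d) ℂ}
    (hM : M.IsHermitian) {t : ℝ} (h : lambdaMax M < t) :
    (t • (1 : Matrix (Fin d) (Fin d) ℂ) - M).PosSemidef := by
  obtain ⟨s, hs, hst⟩ := exists_lt_of_csInf_lt (exists_posSemidef_smul_one_sub hM) h
  exact PosSemidef.smul_one_sub_mono hst.le hs

/-- Every tuple of Hermitian matrices is a combination of positive semidefinite matrices with
coefficient vectors `± e i`. -/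
theorem exists_posSemidef_decomposition {g d : ℕ} {A : Fin g → Matrix (Fin d) (Fin d) ℂ}
    (hA : ∀ i, (A i).IsHermitian) :
    ∃ (n : ℕ) (z : Fin n → Fin g → ℝ) (H : Fin n → Matrix (Fin d) (Fin d) ℂ),
      (∀ j i, |z j i| ≤ 1) ∧ (∀ j, (H j).PosSemidef) ∧ ∀ i, A i = ∑ j, z j i • H j := by
  choose c hc using fun i => exists_posSemidef_smul_one_sub (hA i)
  have hB (i : Fin g) : ∃ B : Matrix (Fin d) (Fin d) ℂ, B.PosSemidef ∧ (B - A i).PosSemidef := by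
    refine ⟨max (c i) 0 • 1, PosSemidef.one.smul (le_max_right _ _), ?_⟩
    exact PosSemidef.smul_one_sub_mono (le_max_left _ _) (hc i)
  choose B hB0 hBA using hB
  refine ⟨g + g, Fin.append (fun j => Pi.single j 1) (fun j => Pi.single j (-1)),
    Fin.append B (fun j => B j - A j), ?_, ?_, ?_⟩
  · intro j i
    refine Fin.addCases (fun k => ?_) (fun k => ?_) j <;>
      simp only [Fin.append_left, Fin.append_right, Pi.single_apply] <;> split_ifs <;> simp
  · intro j
    refine Fin.addCases (fun k => ?_) (fun k => ?_) j
    · rw [Fin.append_left]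
      exact hB0 k
    · rw [Fin.append_right]
      exact hBA k
  · intro i
    simp only [Fin.sum_univ_add, Fin.append_left, Fin.append_right]
    simp [Pi.single_apply]

/-- The vertex of the cube `[-1,1]^g` encoded by a family of Booleans. -/
def cubeVertex {g : ℕ} (s : Fin g → Bool) (i : Fin g) : ℝ := if s i then 1 else -1

theorem abs_cubeVertex {g : ℕ} (s : Fin g → Bool) (i : Fin g) : |cubeVertex s i| = 1 := by
  unfold cubeVertex
  split_ifs <;> simp

theorem exists_cubeVertex_weights {g : ℕ} {z : Fin g → ℝ} (hz : ∀ i, |z i| ≤ 1) :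
    ∃ w : (Fin g → Bool) → ℝ, (∀ s, 0 ≤ w s) ∧ ∑ s, w s = 1 ∧
      ∀ i, ∑ s, w s * cubeVertex s i = z i := by
  let f (i : Fin g) (b : Bool) : ℝ := if b then (1 + z i) / 2 else (1 - z i) / 2
  have hf (i : Fin g) : ∑ b, f i b = 1 := by
    simp only [f, Fintype.sum_bool, if_true, Bool.false_eq_true, if_false]
    ring
  refine ⟨fun s => ∏ i, f i (s i), fun s => Finset.prod_nonneg fun i _ => ?_, ?_, fun i => ?_⟩
  · have := abs_le.1 (hz i)
    simp only [f]
    split_ifs <;> linarith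
  · rw [← Fintype.piFinset_univ, ← Finset.prod_univ_sum]
    exact Finset.prod_eq_one fun i _ => hf i
  · let e (k : Fin g) (b : Bool) : ℝ := if k = i then (if b then 1 else -1) else 1
    have he (s : Fin g → Bool) : cubeVertex s i = ∏ k, e k (s k) := by
      simp [e, cubeVertex, Finset.prod_ite_eq']
    simp_rw [he, ← Finset.prod_mul_distrib]
    rw [← Fintype.piFinset_univ,
      ← Finset.prod_univ_sum (fun _ => Finset.univ) (fun k b => f k b * e k b),
      Finset.prod_eq_single i]
    · simp only [f, e, Fintype.sum_bool, if_true, Bool.false_eq_true, if_false]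
      ring
    · intro k _ hk
      simpa [e, hk] using hf k
    · simp

/-- A decomposition with coefficient vectors in the cube may be pushed to its vertices, keeping
the sum of the matrices. -/
theorem exists_cubeVertex_decomposition {g d n : ℕ} {A : Fin g → Matrix (Fin d) (Fin d) ℂ}
    {z : Fin n → Fin g → ℝ} {H : Fin n → Matrix (Fin d) (Fin d) ℂ}
    (hz : ∀ j i, |z j i| ≤ 1) (hH : ∀ j, (H j).PosSemidef) (hA : ∀ i, A i = ∑ j, z j i • H j) :
    ∃ K : (Fin g → Bool) → Matrix (Fin d) (Fin d) ℂ, (∀ s, (K s).PosSemidef) ∧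
      ∑ s, K s = ∑ j, H j ∧ ∀ i, A i = ∑ s, cubeVertex s i • K s := by
  choose w hw0 hw1 hwz using fun j => exists_cubeVertex_weights (hz j)
  refine ⟨fun s => ∑ j, w j s • H j,
    fun s => posSemidef_sum _ fun j _ => (hH j).smul (hw0 j s), ?_, fun i => ?_⟩
  · rw [Finset.sum_comm]
    simp [← Finset.sum_smul, hw1]
  · simp_rw [hA i, Finset.smul_sum, smul_smul]
    rw [Finset.sum_comm]
    simp_rw [← Finset.sum_smul, mul_comm (cubeVertex _ i), hwz]

/-- The pairs `(t, K)` where `K` decomposes `A` over the vertices of the cube, with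
`∑ s, K s ≤ t • 1` and `t ≤ 2`. -/
def vertexDecompositions {g d : ℕ} (A : Fin g → Matrix (Fin d) (Fin d) ℂ) :
    Set (ℝ × ((Fin g → Bool) → Matrix (Fin d) (Fin d) ℂ)) :=
  {p | p.1 ∈ Set.Icc 0 2 ∧ (∀ s, (p.2 s).PosSemidef) ∧
    (p.1 • (1 : Matrix (Fin d) (Fin d) ℂ) - ∑ s, p.2 s).PosSemidef ∧
    ∀ i, A i = ∑ s, cubeVertex s i • p.2 s}

theorem isCompact_vertexDecompositions {g d : ℕ} (A : Fin g → Matrix (Fin d) (Fin d) ℂ) :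
    IsCompact (vertexDecompositions A) := by
  refine ((isCompact_Icc (a := (0 : ℝ)) (b := 2)).prod
    (isCompact_univ_pi fun _ : Fin g → Bool =>
      isCompact_setOf_posSemidef_le d 2)).of_isClosed_subset ?_ ?_
  · simp only [vertexDecompositions, Set.ofPred_and, Set.ofPred_forall]
    refine IsClosed.inter (isClosed_Icc.preimage continuous_fst) (IsClosed.inter ?_
      (IsClosed.inter ?_ ?_))
    · exact isClosed_iInter fun s => (isClosed_setOf_posSemidef d).preimage
        (f := fun p : ℝ × ((Fin g → Bool) → Matrix (Fin d) (Fin d) ℂ) => p.2 s) (by fun_prop)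
    · exact (isClosed_setOf_posSemidef d).preimage
        (f := fun p : ℝ × ((Fin g → Bool) → Matrix (Fin d) (Fin d) ℂ) =>
          p.1 • (1 : Matrix (Fin d) (Fin d) ℂ) - ∑ s, p.2 s) (by fun_prop)
    · exact isClosed_iInter fun i => isClosed_eq continuous_const (by fun_prop)
  · rintro ⟨t, K⟩ ⟨ht, hK, hsum, -⟩
    refine ⟨ht, fun s _ => ⟨hK s, ?_⟩⟩
    have h := (PosSemidef.smul_one_sub_mono ht.2 hsum).add
      (posSemidef_sum (Finset.univ.erase s) fun j _ => hK j)
    convert! h using 1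
    rw [← Finset.add_sum_erase _ _ (Finset.mem_univ s)]
    abel

theorem exists_mem_vertexDecompositions_of_cNorm_lt {g d : ℕ}
    {A : Fin g → Matrix (Fin d) (Fin d) ℂ} (hA : ∀ i, (A i).IsHermitian) {t : ℝ}
    (ht : t ∈ Set.Icc 0 2) (h : cNorm A < t) : t ∈ Prod.fst '' vertexDecompositions A := by
  obtain ⟨n₀, z₀, H₀, hz₀, hH₀, hA₀⟩ := exists_posSemidef_decomposition hA
  obtain ⟨r, ⟨n, z, H, hz, hH, hAH, rfl⟩, hr⟩ :=
    exists_lt_of_csInf_lt (by exact ⟨_, n₀, z₀, H₀, hz₀, hH₀, hA₀, rfl⟩) h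
  obtain ⟨K, hK, hsum, hAK⟩ := exists_cubeVertex_decomposition hz hH hAH
  refine ⟨(t, K), ⟨ht, hK, ?_, hAK⟩, rfl⟩
  rw [hsum]
  exact posSemidef_smul_one_sub_of_lambdaMax_lt (posSemidef_sum _ fun j _ => hH j).isHermitian hr

theorem one_mem_image_vertexDecompositions {g d : ℕ} {A : Fin g → Matrix (Fin d) (Fin d) ℂ}
    (hA : ∀ i, (A i).IsHermitian) (h : cNorm A ≤ 1) :
    (1 : ℝ) ∈ Prod.fst '' vertexDecompositions A := by
  have hclosed := ((isCompact_vertexDecompositions A).image continuous_fst).isClosed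
  rw [← hclosed.closure_eq, Metric.mem_closure_iff]
  intro ε hε
  have hδ : 0 < min ε 1 := lt_min hε one_pos
  have hδε := min_le_left ε 1
  have hδ1 := min_le_right ε 1
  refine ⟨1 + min ε 1 / 2, exists_mem_vertexDecompositions_of_cNorm_lt hA
    ⟨by linarith, by linarith⟩ (by linarith), ?_⟩
  rw [Real.dist_eq, abs_lt]
  constructor <;> linarith

theorem cNorm_le_lambdaMax {g d n : ℕ} {A : Fin g → Matrix (Fin d) (Fin d) ℂ}
    {z : Fin n → Fin g → ℝ} {H : Fin n → Matrix (Fin d) (Fin d) ℂ}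
    (hz : ∀ j i, |z j i| ≤ 1) (hH : ∀ j, (H j).PosSemidef) (hA : ∀ i, A i = ∑ j, z j i • H j) :
    cNorm A ≤ lambdaMax (∑ j, H j) := by
  refine csInf_le ⟨0, ?_⟩ ⟨n, z, H, hz, hH, hA, rfl⟩
  rintro t ⟨n, z, H, -, hH, -, rfl⟩
  exact lambdaMax_nonneg (posSemidef_sum _ fun j _ => hH j)

/-- the unit ball of the compatibility norm is the level-`d` set of the minimal
matrix convex set over the cube `[-1,1]^g`. -/
theorem cNorm_unit_ball_eq_Wmin (g d : ℕ) (A : Fin g → Matrix (Fin d) (Fin d) ℂ)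
    (hA : ∀ i, (A i).IsHermitian) :
    cNorm A ≤ 1 ↔
      ∃ (n : ℕ) (z : Fin n → Fin g → ℝ) (X : Fin n → Matrix (Fin d) (Fin d) ℂ),
        (∀ j i, |z j i| ≤ 1) ∧ (∀ j, (X j).PosSemidef) ∧ (∑ j, X j = 1) ∧
        ∀ i, A i = ∑ j, z j i • X j := by
  constructor
  · intro h
    obtain ⟨⟨_, K⟩, ⟨-, hK, hsum, hAK⟩, rfl⟩ := one_mem_image_vertexDecompositions hA h
    rw [one_smul] at hsum
    let e := (Fintype.equivFin (Fin g → Bool)).symm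
    refine ⟨_, Fin.cons 0 fun j => cubeVertex (e j), Fin.cons (1 - ∑ s, K s) fun j => K (e j),
      fun j i => ?_, fun j => ?_, ?_, fun i => ?_⟩
    · refine Fin.cases ?_ (fun k => ?_) j
      · simp
      · simp [abs_cubeVertex]
    · exact Fin.cases hsum (fun k => hK _) j
    · simp [Fin.sum_univ_succ, e.sum_comp K]
    · simp [Fin.sum_univ_succ, e.sum_comp fun s => cubeVertex s i • K s, hAK i]
  · rintro ⟨n, z, X, hz, hX, hsum, hAX⟩
    calc cNorm A ≤ lambdaMax (∑ j, X j) := cNorm_le_lambdaMax hz hX hAX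
      _ ≤ 1 := hsum ▸ lambdaMax_one_le d
end
end

section
/- Let φ = (φ_1,…,φ_g) be a g-tuple of d×d Hermitian complex matrices. Then sup{ ∑_{i=1}^g Tr[φ_i A_i] : A = (A_1,…,A_g) a g-tuple of d×d Hermitian matrices with ‖A‖_c ≤ 1 } = inf{ Tr ρ : ρ a d×d Hermitian matrix with ρ − ∑_{i=1}^g ε_i φ_i positive semidefinite for all ε ∈ {−1,1}^g }, and the infimum is attained. That is, the dual of the compatibility norm is given by ‖φ‖_{c*} = min{Tr ρ : ρ ≥ ∑_i ε_i φ_i for all sign vectors ε}. -/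
open Matrix ComplexOrder

noncomputable section

section Auxiliary

variable {g d : ℕ}

/-- The real part of the trace, as a real-linear functional on complex matrices. -/
def reTrace (d : ℕ) : Matrix (Fin d) (Fin d) ℂ →ₗ[ℝ] ℝ :=
  Complex.reLm ∘ₗ Matrix.traceLinearMap (Fin d) ℝ ℂ

lemma reTrace_apply (M : Matrix (Fin d) (Fin d) ℂ) : reTrace d M = M.trace.re := rfl

lemma reTrace_one : reTrace d 1 = d := by
  simp [reTrace_apply]

lemma reTrace_mul_comm (M N : Matrix (Fin d) (Fin d) ℂ) :
    reTrace d (M * N) = reTrace d (N * M) := by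
  simp only [reTrace_apply, Matrix.trace_mul_comm M N]

lemma reTrace_conjTranspose (M : Matrix (Fin d) (Fin d) ℂ) :
    reTrace d Mᴴ = reTrace d M := by
  simp [reTrace_apply, Matrix.trace_conjTranspose]

lemma reTrace_nonneg {M : Matrix (Fin d) (Fin d) ℂ} (hM : M.PosSemidef) : 0 ≤ reTrace d M :=
  (Complex.le_def.1 hM.trace_nonneg).1

lemma reTrace_mul_nonneg {M N : Matrix (Fin d) (Fin d) ℂ} (hM : M.PosSemidef)
    (hN : N.PosSemidef) : 0 ≤ reTrace d (M * N) := by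
  obtain ⟨m, v, rfl⟩ := Matrix.posSemidef_iff_eq_sum_vecMulVec.1 hN
  rw [Finset.mul_sum, map_sum]
  refine Finset.sum_nonneg fun i _ => ?_
  rw [reTrace_apply, Matrix.mul_vecMulVec, Matrix.trace_vecMulVec, dotProduct_comm]
  exact (Complex.le_def.1 (hM.dotProduct_mulVec_nonneg (v i))).1

lemma reTrace_mul_mono {M N P : Matrix (Fin d) (Fin d) ℂ} (h : (N - M).PosSemidef)
    (hP : P.PosSemidef) : reTrace d (M * P) ≤ reTrace d (N * P) := by
  have := reTrace_mul_nonneg h hP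
  rw [sub_mul, map_sub] at this
  linarith

open scoped Matrix.Norms.L2Operator MatrixOrder in
lemma exists_smul_one_sub_posSemidef {M : Matrix (Fin d) (Fin d) ℂ} (hM : M.IsHermitian) :
    ∃ c : ℝ, 0 ≤ c ∧ (c • (1 : Matrix (Fin d) (Fin d) ℂ) - M).PosSemidef := by
  refine ⟨‖M‖, norm_nonneg _, ?_⟩
  have h := IsSelfAdjoint.le_algebraMap_norm_self (a := M) hM
  rwa [Algebra.algebraMap_eq_smul_one, Matrix.le_iff] at h

lemma exists_bound_posSemidef {M : Matrix (Fin d) (Fin d) ℂ} (hM : M.IsHermitian) :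
    ∃ c : ℝ, 0 ≤ c ∧ (c • (1 : Matrix (Fin d) (Fin d) ℂ) - M).PosSemidef ∧
      (c • (1 : Matrix (Fin d) (Fin d) ℂ) + M).PosSemidef := by
  obtain ⟨a, ha, hal⟩ := exists_smul_one_sub_posSemidef hM
  obtain ⟨b, hb, hbl⟩ := exists_smul_one_sub_posSemidef hM.neg
  refine ⟨a + b, by positivity, ?_, ?_⟩
  · have := hal.add (Matrix.PosSemidef.one.smul hb)
    convert this using 1
    module
  · have := hbl.add (Matrix.PosSemidef.one.smul ha)
    convert this using 1
    module

lemma le_of_posSemidef_smul_one_sub {H : Matrix (Fin d) (Fin d) ℂ} (hd : 0 < d)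
    (hH : H.PosSemidef) {t : ℝ}
    (ht : (t • (1 : Matrix (Fin d) (Fin d) ℂ) - H).PosSemidef) : 0 ≤ t := by
  have h := reTrace_nonneg (ht.add hH)
  rw [sub_add_cancel, map_smul, reTrace_one, smul_eq_mul] at h
  exact nonneg_of_mul_nonneg_left h (by exact_mod_cast hd)

lemma lambdaMax_nonneg_s13 {H : Matrix (Fin d) (Fin d) ℂ} (hH : H.PosSemidef) :
    0 ≤ lambdaMax H := by
  rcases Nat.eq_zero_or_pos d with rfl | hd
  · have : {t : ℝ | (t • (1 : Matrix (Fin 0) (Fin 0) ℂ) - H).PosSemidef} = Set.univ :=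
      Set.eq_univ_of_forall fun t => by
        rw [Set.mem_ofPred_eq, Subsingleton.elim (_ - H) 0]; exact .zero
    rw [lambdaMax, this, Real.sInf_univ]
  · exact Real.sInf_nonneg fun t ht => le_of_posSemidef_smul_one_sub hd hH ht

lemma lambdaMax_le {H : Matrix (Fin d) (Fin d) ℂ} (hH : H.PosSemidef) {t : ℝ} (h0 : 0 ≤ t)
    (ht : (t • (1 : Matrix (Fin d) (Fin d) ℂ) - H).PosSemidef) : lambdaMax H ≤ t := by
  rcases Nat.eq_zero_or_pos d with rfl | hd
  · have : {t : ℝ | (t • (1 : Matrix (Fin 0) (Fin 0) ℂ) - H).PosSemidef} = Set.univ :=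
      Set.eq_univ_of_forall fun t => by
        rw [Set.mem_ofPred_eq, Subsingleton.elim (_ - H) 0]; exact .zero
    rw [lambdaMax, this, Real.sInf_univ]
    exact h0
  · exact csInf_le ⟨0, fun s hs => le_of_posSemidef_smul_one_sub hd hH hs⟩ ht

lemma posSemidef_smul_one_sub_of_lambdaMax_lt_s13 {H : Matrix (Fin d) (Fin d) ℂ}
    (hH : H.IsHermitian) {t : ℝ} (ht : lambdaMax H < t) :
    (t • (1 : Matrix (Fin d) (Fin d) ℂ) - H).PosSemidef := by
  obtain ⟨c, -, hc⟩ := exists_smul_one_sub_posSemidef hH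
  obtain ⟨s, hs, hst⟩ := exists_lt_of_csInf_lt ⟨c, hc⟩ ht
  have := Matrix.PosSemidef.add hs (Matrix.PosSemidef.one.smul (sub_nonneg.2 hst.le))
  convert this using 1
  module

/-- A compatible decomposition indexed by an arbitrary finite type can be indexed by some
`Fin n`, as in the definition of `cNorm`. -/
lemma lambdaMax_mem_decompositions {ι : Type*} [Fintype ι] {A : Fin g → Matrix (Fin d) (Fin d) ℂ}
    (z : ι → Fin g → ℝ) (H : ι → Matrix (Fin d) (Fin d) ℂ) (hz : ∀ j i, |z j i| ≤ 1)
    (hH : ∀ j, (H j).PosSemidef) (hA : ∀ i, A i = ∑ j, z j i • H j) :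
    ∃ (n : ℕ) (z : Fin n → Fin g → ℝ) (H' : Fin n → Matrix (Fin d) (Fin d) ℂ),
      (∀ j i, |z j i| ≤ 1) ∧ (∀ j, (H' j).PosSemidef) ∧
      (∀ i, A i = ∑ j, z j i • H' j) ∧ lambdaMax (∑ j, H j) = lambdaMax (∑ j, H' j) := by
  let e := (Fintype.equivFin ι).symm
  refine ⟨_, fun j => z (e j), fun j => H (e j), fun j => hz _, fun j => hH _, fun i => ?_, ?_⟩
  · rw [hA, ← e.sum_comp]
  · rw [← e.sum_comp]

lemma cNorm_le {ι : Type*} [Fintype ι] {A : Fin g → Matrix (Fin d) (Fin d) ℂ}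
    (z : ι → Fin g → ℝ) (H : ι → Matrix (Fin d) (Fin d) ℂ) (hz : ∀ j i, |z j i| ≤ 1)
    (hH : ∀ j, (H j).PosSemidef) (hA : ∀ i, A i = ∑ j, z j i • H j) :
    cNorm A ≤ lambdaMax (∑ j, H j) := by
  refine csInf_le ⟨0, ?_⟩ (lambdaMax_mem_decompositions z H hz hH hA)
  rintro _ ⟨n, z, H, -, hH, -, rfl⟩
  exact lambdaMax_nonneg_s13 (Matrix.posSemidef_sum _ fun j _ => hH j)

lemma exists_decomposition_of_cNorm_lt {A : Fin g → Matrix (Fin d) (Fin d) ℂ}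
    (hA : ∀ i, (A i).IsHermitian) {t : ℝ} (ht : cNorm A < t) :
    ∃ (n : ℕ) (z : Fin n → Fin g → ℝ) (H : Fin n → Matrix (Fin d) (Fin d) ℂ),
      (∀ j i, |z j i| ≤ 1) ∧ (∀ j, (H j).PosSemidef) ∧ (∀ i, A i = ∑ j, z j i • H j) ∧
      (t • (1 : Matrix (Fin d) (Fin d) ℂ) - ∑ j, H j).PosSemidef := by
  choose c _ hsub hadd using fun i => exists_bound_posSemidef (hA i)
  have hne := lambdaMax_mem_decompositions (A := A)
    (Sum.elim (fun j => Pi.single j 1) (fun j => -Pi.single j 1) : Fin g ⊕ Fin g → Fin g → ℝ)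
    (Sum.elim (fun j => (1 / 2 : ℝ) • (c j • 1 + A j)) (fun j => (1 / 2 : ℝ) • (c j • 1 - A j)))
    (by
      rintro (j | j) i <;> rcases eq_or_ne i j with rfl | h <;> simp [*])
    (by
      rintro (j | j)
      · exact (hadd j).smul (by norm_num)
      · exact (hsub j).smul (by norm_num))
    (by
      intro i
      simp only [Fintype.sum_sum_type, Sum.elim_inl, Sum.elim_inr, Pi.neg_apply, neg_smul,
        Finset.sum_neg_distrib, Pi.single_apply, ite_smul, one_smul, zero_smul,
        Finset.sum_ite_eq, Finset.mem_univ, if_true]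
      module)
  obtain ⟨_, ⟨n, z, H, hz, hH, hAz, rfl⟩, hlt⟩ :=
    exists_lt_of_csInf_lt (by exact ⟨_, hne⟩) ht
  exact ⟨n, z, H, hz, hH, hAz, posSemidef_smul_one_sub_of_lambdaMax_lt_s13
    (Matrix.posSemidef_sum _ fun j _ => hH j).isHermitian hlt⟩

/-- The signed sum `∑ i, ε i • φ i`. -/
abbrev signSum (φ : Fin g → Matrix (Fin d) (Fin d) ℂ) (ε : Fin g → Bool) :
    Matrix (Fin d) (Fin d) ℂ :=
  ∑ i, (if ε i then (1 : ℝ) else -1) • φ i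

lemma signSum_isHermitian {φ : Fin g → Matrix (Fin d) (Fin d) ℂ} (hφ : ∀ i, (φ i).IsHermitian)
    (ε : Fin g → Bool) : (signSum φ ε).IsHermitian := by
  simp only [signSum, Matrix.IsHermitian, Matrix.conjTranspose_sum, Matrix.conjTranspose_smul,
    star_trivial, fun i => (hφ i).eq]

lemma exists_posSemidef_sub_signSum {φ : Fin g → Matrix (Fin d) (Fin d) ℂ}
    (hφ : ∀ i, (φ i).IsHermitian) :
    ∃ ρ : Matrix (Fin d) (Fin d) ℂ, ρ.IsHermitian ∧ ∀ ε, (ρ - signSum φ ε).PosSemidef := by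
  choose c hc hsub hadd using fun i => exists_bound_posSemidef (hφ i)
  refine ⟨∑ i, c i • 1, (Matrix.posSemidef_sum _ fun i _ =>
    Matrix.PosSemidef.one.smul (hc i)).isHermitian, fun ε => ?_⟩
  rw [← Finset.sum_sub_distrib]
  refine Matrix.posSemidef_sum _ fun i _ => ?_
  split_ifs
  · simpa using hsub i
  · simpa using hadd i

lemma posSemidef_of_sub_signSum {φ : Fin g → Matrix (Fin d) (Fin d) ℂ}
    {ρ : Matrix (Fin d) (Fin d) ℂ} (hρ : ∀ ε, (ρ - signSum φ ε).PosSemidef) :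
    ρ.PosSemidef := by
  have h := ((hρ fun _ => true).add (hρ fun _ => false)).smul (by norm_num : (0 : ℝ) ≤ 1 / 2)
  convert h using 1
  simp [signSum, ← two_smul ℝ ρ, smul_smul]

/-- A matrix dominating all signed sums also dominates, when tested on a positive matrix,
all combinations with coefficients in `[-1, 1]`. -/
lemma sum_mul_reTrace_le {φ : Fin g → Matrix (Fin d) (Fin d) ℂ}
    {ρ H : Matrix (Fin d) (Fin d) ℂ} (hρ : ∀ ε, (ρ - signSum φ ε).PosSemidef)
    (hH : H.PosSemidef) {z : Fin g → ℝ} (hz : ∀ i, |z i| ≤ 1) :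
    ∑ i, z i * reTrace d (φ i * H) ≤ reTrace d (ρ * H) := by
  let ε : Fin g → Bool := fun i => decide (0 ≤ reTrace d (φ i * H))
  refine le_trans ?_ (reTrace_mul_mono (hρ ε) hH)
  rw [signSum, Finset.sum_mul, map_sum]
  refine Finset.sum_le_sum fun i _ => ?_
  rw [Matrix.smul_mul, map_smul, smul_eq_mul]
  obtain ⟨h1, h2⟩ := abs_le.1 (hz i)
  by_cases h : 0 ≤ reTrace d (φ i * H)
  · simp only [ε, h, decide_true, if_true]
    exact mul_le_mul_of_nonneg_right h2 h
  · simp only [ε, h, decide_false, Bool.false_eq_true, if_false]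
    exact mul_le_mul_of_nonpos_right h1 (not_le.1 h).le

lemma sum_reTrace_le_of_cNorm_le_one {φ A : Fin g → Matrix (Fin d) (Fin d) ℂ}
    {ρ : Matrix (Fin d) (Fin d) ℂ} (hρ : ∀ ε, (ρ - signSum φ ε).PosSemidef)
    (hA : ∀ i, (A i).IsHermitian) (hc : cNorm A ≤ 1) :
    ∑ i, reTrace d (φ i * A i) ≤ reTrace d ρ := by
  have hρ0 := posSemidef_of_sub_signSum hρ
  have key : ∀ t : ℝ, 1 < t → ∑ i, reTrace d (φ i * A i) ≤ t * reTrace d ρ := by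
    intro t ht
    obtain ⟨n, z, H, hz, hH, hAz, hle⟩ := exists_decomposition_of_cNorm_lt hA (hc.trans_lt ht)
    calc ∑ i, reTrace d (φ i * A i)
        = ∑ j, ∑ i, z j i * reTrace d (φ i * H j) := by
          rw [Finset.sum_comm]
          refine Finset.sum_congr rfl fun i _ => ?_
          rw [hAz i, Finset.mul_sum, map_sum]
          simp only [Matrix.mul_smul, map_smul, smul_eq_mul]
      _ ≤ ∑ j, reTrace d (ρ * H j) :=
          Finset.sum_le_sum fun j _ => sum_mul_reTrace_le hρ (hH j) (hz j)
      _ = reTrace d ((∑ j, H j) * ρ) := by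
          rw [reTrace_mul_comm, Finset.mul_sum, map_sum]
      _ ≤ reTrace d ((t • (1 : Matrix (Fin d) (Fin d) ℂ)) * ρ) := reTrace_mul_mono hle hρ0
      _ = t * reTrace d ρ := by rw [Matrix.smul_mul, one_mul, map_smul, smul_eq_mul]
  have hlim : Filter.Tendsto (fun t : ℝ => t * reTrace d ρ) (nhdsWithin 1 (Set.Ioi 1))
      (nhds (1 * reTrace d ρ)) :=
    (Continuous.tendsto (by fun_prop) 1).mono_left nhdsWithin_le_nhds
  rw [one_mul] at hlim
  exact ge_of_tendsto hlim (eventually_mem_nhdsWithin.mono fun t ht => key t ht)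

/-- Every real-linear functional on matrices is represented, on Hermitian matrices, by the
trace pairing with a Hermitian matrix. -/
lemma exists_isHermitian_reTrace_mul (f : Matrix (Fin d) (Fin d) ℂ →ₗ[ℝ] ℝ) :
    ∃ ρ : Matrix (Fin d) (Fin d) ℂ, ρ.IsHermitian ∧
      ∀ S : Matrix (Fin d) (Fin d) ℂ, S.IsHermitian → f S = reTrace d (ρ * S) := by
  let σ : Matrix (Fin d) (Fin d) ℂ := Matrix.of fun i j =>
    ⟨f (Matrix.single j i 1), -f (Matrix.single j i Complex.I)⟩
  have hσ : ∀ S, f S = reTrace d (σ * S) := by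
    intro S
    have hS : S = ∑ i, ∑ j, ((S i j).re • Matrix.single i j (1 : ℂ) +
        (S i j).im • Matrix.single i j Complex.I) := by
      conv_lhs => rw [Matrix.matrix_eq_sum_single S]
      refine Finset.sum_congr rfl fun i _ => Finset.sum_congr rfl fun j _ => ?_
      rw [Matrix.smul_single, Matrix.smul_single, ← Matrix.single_add]
      congr 1
      simp [Complex.re_add_im]
    conv_lhs => rw [hS]
    simp only [map_sum, map_add, map_smul, smul_eq_mul, reTrace_apply, Matrix.trace,
      Matrix.diag_apply, Matrix.mul_apply, Complex.re_sum, Complex.mul_re, σ, Matrix.of_apply]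
    rw [Finset.sum_comm]
    refine Finset.sum_congr rfl fun i _ => Finset.sum_congr rfl fun j _ => ?_
    ring
  refine ⟨(1 / 2 : ℝ) • (σ + σᴴ), ?_, fun S hS => ?_⟩
  · rw [Matrix.IsHermitian, Matrix.conjTranspose_smul, Matrix.conjTranspose_add,
      Matrix.conjTranspose_conjTranspose, star_trivial, add_comm]
  · have h : reTrace d (σᴴ * S) = reTrace d (σ * S) := by
      rw [← reTrace_conjTranspose, Matrix.conjTranspose_mul, Matrix.conjTranspose_conjTranspose,
        hS.eq, reTrace_mul_comm]
    rw [hσ, Matrix.smul_mul, add_mul, map_smul, map_add, h, smul_eq_mul]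
    ring

lemma posSemidef_of_reTrace_mul_nonneg {M : Matrix (Fin d) (Fin d) ℂ} (hM : M.IsHermitian)
    (h : ∀ S : Matrix (Fin d) (Fin d) ℂ, S.PosSemidef → 0 ≤ reTrace d (M * S)) :
    M.PosSemidef := by
  refine .of_dotProduct_mulVec_nonneg hM fun x => ?_
  have hx := h _ (Matrix.posSemidef_vecMulVec_self_star x)
  rw [reTrace_apply, Matrix.mul_vecMulVec, Matrix.trace_vecMulVec, dotProduct_comm] at hx
  exact Complex.le_def.2 ⟨hx, (hM.im_star_dotProduct_mulVec_self x).symm⟩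

/-- The hypograph of the concave gauge
`S ↦ sup {∑ ε, Tr (signSum φ ε * H ε) : H ε ≥ 0, ∑ ε, H ε = S}`, extended to all matrices through
the Hermitian part. -/
def gaugeHypograph (φ : Fin g → Matrix (Fin d) (Fin d) ℂ) :
    PointedCone ℝ (Matrix (Fin d) (Fin d) ℂ × ℝ) where
  carrier := {p | ∃ H : (Fin g → Bool) → Matrix (Fin d) (Fin d) ℂ, (∀ ε, (H ε).PosSemidef) ∧
    p.1 + p.1ᴴ = (2 : ℝ) • ∑ ε, H ε ∧ p.2 ≤ ∑ ε, reTrace d (signSum φ ε * H ε)}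
  zero_mem' := ⟨0, fun _ => .zero, by simp, by simp⟩
  add_mem' := by
    rintro p q ⟨H, hH, hp, hp'⟩ ⟨K, hK, hq, hq'⟩
    refine ⟨H + K, fun ε => (hH ε).add (hK ε), ?_, ?_⟩
    · simp only [Prod.fst_add, Matrix.conjTranspose_add, Pi.add_apply, Finset.sum_add_distrib,
        smul_add, ← hp, ← hq]
      abel
    · simp only [Prod.snd_add, Pi.add_apply, mul_add, map_add, Finset.sum_add_distrib]
      exact add_le_add hp' hq'
  smul_mem' := by
    rintro ⟨c, hc⟩ p ⟨H, hH, hp, hp'⟩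
    refine ⟨c • H, fun ε => (hH ε).smul hc, ?_, ?_⟩
    · change c • p.1 + (c • p.1)ᴴ = _
      simp only [Matrix.conjTranspose_smul, star_trivial, ← smul_add, hp, Pi.smul_apply,
        ← Finset.smul_sum]
      exact smul_comm _ _ _
    · change c * p.2 ≤ _
      simp only [Pi.smul_apply, Matrix.mul_smul, map_smul, smul_eq_mul, ← Finset.mul_sum]
      exact mul_le_mul_of_nonneg_left hp' hc

lemma mem_gaugeHypograph {φ : Fin g → Matrix (Fin d) (Fin d) ℂ}
    {p : Matrix (Fin d) (Fin d) ℂ × ℝ} :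
    p ∈ gaugeHypograph φ ↔ ∃ H : (Fin g → Bool) → Matrix (Fin d) (Fin d) ℂ,
      (∀ ε, (H ε).PosSemidef) ∧ p.1 + p.1ᴴ = (2 : ℝ) • ∑ ε, H ε ∧
      p.2 ≤ ∑ ε, reTrace d (signSum φ ε * H ε) := Iff.rfl

lemma mem_gaugeHypograph_of_posSemidef {φ : Fin g → Matrix (Fin d) (Fin d) ℂ}
    {S : Matrix (Fin d) (Fin d) ℂ} (ε : Fin g → Bool) (hS : (S + Sᴴ).PosSemidef) {t : ℝ}
    (ht : t ≤ reTrace d (signSum φ ε * ((1 / 2 : ℝ) • (S + Sᴴ)))) :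
    (S, t) ∈ gaugeHypograph φ := by
  refine mem_gaugeHypograph.2 ⟨Pi.single ε ((1 / 2 : ℝ) • (S + Sᴴ)), fun δ => ?_, ?_, ?_⟩
  · rcases eq_or_ne δ ε with rfl | h
    · simpa using hS.smul (by norm_num : (0 : ℝ) ≤ 1 / 2)
    · simpa [h] using Matrix.PosSemidef.zero
  · rw [Finset.sum_pi_single']
    simp [smul_smul]
  · refine ht.trans_eq ?_
    rw [Fintype.sum_eq_single ε fun δ h => by simp [h], Pi.single_eq_same]

/-- Decompositions of a multiple `a • 1` are controlled by a bound of `φ` on the unit ball of the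
compatibility norm. -/
lemma sum_reTrace_signSum_le {φ : Fin g → Matrix (Fin d) (Fin d) ℂ} {s a : ℝ} (hd : 0 < d)
    (hs : ∀ A : Fin g → Matrix (Fin d) (Fin d) ℂ, (∀ i, (A i).IsHermitian) → cNorm A ≤ 1 →
      ∑ i, reTrace d (φ i * A i) ≤ s)
    {H : (Fin g → Bool) → Matrix (Fin d) (Fin d) ℂ} (hH : ∀ ε, (H ε).PosSemidef)
    (hsum : ∑ ε, H ε = a • 1) :
    ∑ ε, reTrace d (signSum φ ε * H ε) ≤ a * s := by
  have hd' : (0 : ℝ) < d := by exact_mod_cast hd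
  have htr : ∑ ε, reTrace d (H ε) = a * d := by
    rw [← map_sum, hsum, map_smul, reTrace_one, smul_eq_mul]
  have ha : 0 ≤ a := nonneg_of_mul_nonneg_left
    (htr ▸ Finset.sum_nonneg fun ε _ => reTrace_nonneg (hH ε)) hd'
  rcases ha.eq_or_lt with rfl | ha
  · have h0 : ∀ ε, H ε = 0 := by
      intro ε
      rw [zero_mul, Finset.sum_eq_zero_iff_of_nonneg fun ε _ => reTrace_nonneg (hH ε)] at htr
      rw [← (hH ε).trace_eq_zero_iff]
      exact Complex.ext (htr ε (Finset.mem_univ _))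
        (Complex.le_def.1 (hH ε).trace_nonneg).2.symm
    simp [h0]
  · let z : (Fin g → Bool) → Fin g → ℝ := fun ε i => if ε i then 1 else -1
    let A : Fin g → Matrix (Fin d) (Fin d) ℂ := fun i => ∑ ε, z ε i • (a⁻¹ • H ε)
    have hK : ∀ ε, (a⁻¹ • H ε).PosSemidef := fun ε => (hH ε).smul (inv_nonneg.2 ha.le)
    have hKsum : ∑ ε, a⁻¹ • H ε = 1 := by
      rw [← Finset.smul_sum, hsum, smul_smul, inv_mul_cancel₀ ha.ne', one_smul]
    have hA : ∀ i, (A i).IsHermitian := fun i => by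
      simp only [A, Matrix.IsHermitian, Matrix.conjTranspose_sum, Matrix.conjTranspose_smul,
        star_trivial, fun ε => (hH ε).isHermitian.eq]
    have hc : cNorm A ≤ 1 := by
      refine (cNorm_le z _ (fun ε i => ?_) hK fun i => rfl).trans ?_
      · simp only [z]; split_ifs <;> simp
      · rw [hKsum]
        exact lambdaMax_le .one zero_le_one (by simpa using Matrix.PosSemidef.zero)
    have hval : ∑ i, reTrace d (φ i * A i) = a⁻¹ * ∑ ε, reTrace d (signSum φ ε * H ε) := by
      simp only [A, signSum, Finset.mul_sum, Finset.sum_mul, map_sum, Matrix.mul_smul,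
        Matrix.smul_mul, map_smul, smul_eq_mul]
      rw [Finset.sum_comm]
      refine Finset.sum_congr rfl fun ε _ => Finset.sum_congr rfl fun i _ => ?_
      simp only [z]
      ring
    have := hs A hA hc
    rwa [hval, inv_mul_le_iff₀ ha] at this

/-- Strong duality: a bound of `φ` on the unit ball of the compatibility norm is the trace of
some matrix dominating all signed sums. -/
lemma exists_reTrace_eq {φ : Fin g → Matrix (Fin d) (Fin d) ℂ}
    (hφ : ∀ i, (φ i).IsHermitian) {s : ℝ} (hd : 0 < d)
    (hs : ∀ A : Fin g → Matrix (Fin d) (Fin d) ℂ, (∀ i, (A i).IsHermitian) → cNorm A ≤ 1 →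
      ∑ i, reTrace d (φ i * A i) ≤ s) :
    ∃ ρ : Matrix (Fin d) (Fin d) ℂ, ρ.IsHermitian ∧ (∀ ε, (ρ - signSum φ ε).PosSemidef) ∧
      reTrace d ρ = s := by
  have hd' : (0 : ℝ) < d := by exact_mod_cast hd
  let F : Matrix (Fin d) (Fin d) ℂ × ℝ →ₗ[ℝ] ℝ :=
    (s / d) • (reTrace d ∘ₗ LinearMap.fst ℝ _ _) - LinearMap.snd ℝ _ _
  have hF : ∀ S t, F (S, t) = s / d * reTrace d S - t := fun S t => rfl
  let f : (Matrix (Fin d) (Fin d) ℂ × ℝ) →ₗ.[ℝ] ℝ :=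
    ⟨(Submodule.span ℝ {(1 : Matrix (Fin d) (Fin d) ℂ)}).prod ⊤, F.domRestrict _⟩
  obtain ⟨G, hGf, hG⟩ := riesz_extension (gaugeHypograph φ) f
    (by
      rintro ⟨⟨S, t⟩, hS, _⟩ hmem
      obtain ⟨a, rfl : a • 1 = S⟩ := Submodule.mem_span_singleton.1 hS
      obtain ⟨H, hH, hsum, ht⟩ := mem_gaugeHypograph.1 hmem
      have hsum' : ∑ ε, H ε = a • 1 := by
        simp only [Matrix.conjTranspose_smul, star_trivial, Matrix.conjTranspose_one,
          ← two_smul ℝ (a • (1 : Matrix (Fin d) (Fin d) ℂ))] at hsum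
        exact (smul_right_injective _ (two_ne_zero' ℝ) hsum).symm
      have hle := ht.trans (sum_reTrace_signSum_le hd hs hH hsum')
      change 0 ≤ F (a • 1, t)
      rw [hF, map_smul, reTrace_one, smul_eq_mul]
      field_simp
      simp only at hle
      linarith)
    (by
      rintro ⟨S, t⟩
      obtain ⟨c, -, -, hc⟩ := exists_bound_posSemidef (Matrix.isHermitian_add_transpose_self S)
      let T := (c / 2) • (1 : Matrix (Fin d) (Fin d) ℂ) + S
      have hT : (T + Tᴴ).PosSemidef := by
        convert hc using 1
        simp only [T, Matrix.conjTranspose_add, Matrix.conjTranspose_smul, star_trivial,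
          Matrix.conjTranspose_one]
        module
      let u := reTrace d (signSum φ (fun _ => true) * ((1 / 2 : ℝ) • (T + Tᴴ)))
      refine ⟨⟨((c / 2) • 1, u - t), Submodule.mem_span_singleton.2 ⟨_, rfl⟩, trivial⟩, ?_⟩
      change (T, u - t + t) ∈ _
      exact mem_gaugeHypograph_of_posSemidef (fun _ => true) hT (by simp [u]))
  have hG' : ∀ a t : ℝ, G (a • 1, t) = s * a - t := by
    intro a t
    have := hGf ⟨(a • 1, t), Submodule.mem_span_singleton.2 ⟨_, rfl⟩, trivial⟩
    refine this.trans ?_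
    change F (a • 1, t) = _
    rw [hF, map_smul, reTrace_one, smul_eq_mul]
    field_simp
  obtain ⟨ρ, hρ, hρG⟩ := exists_isHermitian_reTrace_mul (G ∘ₗ LinearMap.inl ℝ _ ℝ)
  have hρG' : ∀ S : Matrix (Fin d) (Fin d) ℂ, S.IsHermitian → G (S, 0) = reTrace d (ρ * S) := hρG
  refine ⟨ρ, hρ, fun ε => ?_, ?_⟩
  · refine posSemidef_of_reTrace_mul_nonneg (hρ.sub (signSum_isHermitian hφ ε)) fun S hS => ?_
    have hSS : (1 / 2 : ℝ) • (S + Sᴴ) = S := by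
      rw [hS.isHermitian.eq, ← two_smul ℝ S, smul_smul]
      norm_num
    have h := hG _ (mem_gaugeHypograph_of_posSemidef (φ := φ) ε (hS.add hS.conjTranspose) le_rfl)
    have h0 : G (0, reTrace d (signSum φ ε * S)) = -reTrace d (signSum φ ε * S) := by
      simpa using hG' 0 (reTrace d (signSum φ ε * S))
    rw [hSS, ← add_zero S, ← zero_add (reTrace d _), ← Prod.mk_add_mk, map_add, add_zero,
      hρG' S hS.isHermitian, h0] at h
    rw [sub_mul, map_sub]
    linarith
  · have h := hG' 1 0
    rw [one_smul, hρG' 1 Matrix.isHermitian_one] at h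
    simpa using h

end Auxiliary

/-- the dual of the compatibility norm is
`‖φ‖_{c*} = min {Tr ρ : ρ ≥ ∑ i, ε i • φ i  for all sign vectors ε}`, the minimum being
attained and equal to the supremum over the unit ball of `‖·‖_c`. -/
theorem cNorm_dual (g d : ℕ) (φ : Fin g → Matrix (Fin d) (Fin d) ℂ)
    (hφ : ∀ i, (φ i).IsHermitian) :
    IsLeast {t : ℝ | ∃ ρ : Matrix (Fin d) (Fin d) ℂ, ρ.IsHermitian ∧
        (∀ ε : Fin g → Bool,
          (ρ - ∑ i, (if ε i then (1 : ℝ) else -1) • φ i).PosSemidef) ∧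
        t = ρ.trace.re}
      (sSup {t : ℝ | ∃ A : Fin g → Matrix (Fin d) (Fin d) ℂ,
        (∀ i, (A i).IsHermitian) ∧ cNorm A ≤ 1 ∧
        t = ∑ i, ((φ i * A i).trace).re}) := by
  have hbdd : BddAbove {t : ℝ | ∃ A : Fin g → Matrix (Fin d) (Fin d) ℂ,
      (∀ i, (A i).IsHermitian) ∧ cNorm A ≤ 1 ∧ t = ∑ i, ((φ i * A i).trace).re} := by
    obtain ⟨ρ, -, hρ⟩ := exists_posSemidef_sub_signSum hφ
    refine ⟨reTrace d ρ, ?_⟩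
    rintro _ ⟨A, hA, hc, rfl⟩
    exact sum_reTrace_le_of_cNorm_le_one hρ hA hc
  constructor
  · rcases Nat.eq_zero_or_pos d with rfl | hd
    · refine ⟨0, Matrix.isHermitian_zero, fun ε => ?_, ?_⟩
      · rw [Subsingleton.elim (0 - _) (0 : Matrix (Fin 0) (Fin 0) ℂ)]
        exact .zero
      · refine le_antisymm (Real.sSup_nonpos ?_) (Real.sSup_nonneg ?_) <;>
          rintro _ ⟨A, -, -, rfl⟩ <;> simp
    · obtain ⟨ρ, hρ, hle, htr⟩ := exists_reTrace_eq hφ hd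
        fun A hA hc => le_csSup hbdd ⟨A, hA, hc, rfl⟩
      exact ⟨ρ, hρ, hle, htr.symm⟩
  · rintro _ ⟨ρ, -, hρ, rfl⟩
    refine Real.sSup_le ?_ (reTrace_nonneg (posSemidef_of_sub_signSum hρ))
    rintro _ ⟨A, hA, hc, rfl⟩
    exact sum_reTrace_le_of_cNorm_le_one hρ hA hc
end
end
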